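/- Let d ≥ 2, 0 < α < 1, let h_α(t) := Σ_{k=0}^∞ 2^{−kα} cos(2π·2^k t), let a > 0 satisfy a·d·Σ_{k=0}^∞ 2^{−kα} ≤ 1/2, and let W(x,y) := 1/2 + a Σ_{i=1}^d h_α(x_i − y_i) on [0,1]^d × [0,1]^d. Then for every β > α/d, W is not equivalent to any graphon W' on [0,1] that is Hölder(β); that is, there do not exist a Hölder(β) graphon W' on [0,1], a graphon U on a probability space (S, μ), and measure-preserving maps φ₁ : [0,1]^d → S and φ₂ : [0,1] → S such that W(x,y) = U(φ₁(x), φ₁(y)) a.e. on [0,1]^{2d} and W'(x,y) = U(φ₂(x), φ₂(y)) a.e. on [0,1]². -/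

import Mathlib

open MeasureTheory
open scoped ENNReal

/-- The unit cube `[0,1]^d` in Euclidean space. -/
def unitCube (d : ℕ) : Set (EuclideanSpace ℝ (Fin d)) :=
  {x | ∀ i, x i ∈ Set.Icc (0:ℝ) 1}

/-- The Weierstrass function `h_α(t) = Σ_{k≥0} 2^{−kα} cos(2π·2^k t)`. -/
noncomputable def weierstrass (α : ℝ) (t : ℝ) : ℝ :=
  ∑' k : ℕ, (2:ℝ) ^ (-(k:ℝ) * α) * Real.cos (2 * Real.pi * 2 ^ k * t)

/-- The Weierstrass-type graphon `W(x,y) = 1/2 + a Σ_i h_α(x_i − y_i)` on `[0,1]^d`. -/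
noncomputable def weierstrassGraphon (d : ℕ) (α a : ℝ)
    (x y : EuclideanSpace ℝ (Fin d)) : ℝ :=
  1 / 2 + a * ∑ i, weierstrass α (x i - y i)

/-- Two graphons (given with their underlying probability measures) are equivalent if both
are a.e. equal to pull-backs of a common graphon `U` on some probability space `(S, μ)`. -/
def GraphonEquiv {S₁ S₂ : Type} [MeasurableSpace S₁] [MeasurableSpace S₂]
    (μ₁ : Measure S₁) (μ₂ : Measure S₂) (W₁ : S₁ → S₁ → ℝ) (W₂ : S₂ → S₂ → ℝ) : Prop :=
  ∃ (S : Type) (mS : MeasurableSpace S),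
    letI := mS
    ∃ (μ : Measure S) (U : S → S → ℝ) (φ₁ : S₁ → S) (φ₂ : S₂ → S),
      IsProbabilityMeasure μ ∧
      Measurable (Function.uncurry U) ∧
      (∀ x y, U x y = U y x) ∧
      (∀ x y, U x y ∈ Set.Icc (0:ℝ) 1) ∧
      MeasurePreserving φ₁ μ₁ μ ∧
      MeasurePreserving φ₂ μ₂ μ ∧
      (∀ᵐ p ∂(μ₁.prod μ₁), W₁ p.1 p.2 = U (φ₁ p.1) (φ₁ p.2)) ∧
      (∀ᵐ p ∂(μ₂.prod μ₂), W₂ p.1 p.2 = U (φ₂ p.1) (φ₂ p.2))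

/-! ### The `L¹` neighbourhood pseudometric of a graphon -/

/-- The `L¹` distance between the sections `W x` and `W x'`. -/
noncomputable def sectionDist {S : Type} [MeasurableSpace S] (μ : Measure S) (W : S → S → ℝ)
    (x x' : S) : ℝ≥0∞ :=
  ∫⁻ y, ‖W x y - W x' y‖ₑ ∂μ

/-- The measure of the set of pairs of points at section distance at most `ε`. -/
noncomputable def nearPairs {S : Type} [MeasurableSpace S] (μ : Measure S) (W : S → S → ℝ)
    (ε : ℝ≥0∞) : ℝ≥0∞ :=
  (μ.prod μ) {p | sectionDist μ W p.1 p.2 ≤ ε}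

lemma measurable_sectionDist {S : Type} [MeasurableSpace S] {μ : Measure S} [SFinite μ]
    {U : S → S → ℝ} (hU : Measurable (Function.uncurry U)) :
    Measurable fun p : S × S => sectionDist μ U p.1 p.2 := by
  unfold sectionDist
  refine Measurable.lintegral_prod_right' (f := fun q : (S × S) × S =>
    ‖U q.1.1 q.2 - U q.1.2 q.2‖ₑ) ?_
  have h₁ : Measurable fun q : (S × S) × S => U q.1.1 q.2 :=
    hU.comp (by fun_prop : Measurable fun q : (S × S) × S => (q.1.1, q.2))
  have h₂ : Measurable fun q : (S × S) × S => U q.1.2 q.2 :=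
    hU.comp (by fun_prop : Measurable fun q : (S × S) × S => (q.1.2, q.2))
  exact (h₁.sub h₂).enorm

lemma nearPairs_eq_of_pullback {S₁ S : Type} [MeasurableSpace S₁] [MeasurableSpace S]
    {μ₁ : Measure S₁} {μ : Measure S} [SFinite μ₁] [SFinite μ] {W : S₁ → S₁ → ℝ} {U : S → S → ℝ}
    {φ : S₁ → S} (hU : Measurable (Function.uncurry U)) (hφ : MeasurePreserving φ μ₁ μ)
    (hW : ∀ᵐ p ∂(μ₁.prod μ₁), W p.1 p.2 = U (φ p.1) (φ p.2)) (ε : ℝ≥0∞) :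
    nearPairs μ₁ W ε = nearPairs μ U ε := by
  have hsec := Measure.ae_ae_of_ae_prod hW
  have hdist : ∀ᵐ p ∂(μ₁.prod μ₁), sectionDist μ₁ W p.1 p.2 = sectionDist μ U (φ p.1) (φ p.2) := by
    filter_upwards [Measure.quasiMeasurePreserving_fst.ae hsec,
      Measure.quasiMeasurePreserving_snd.ae hsec] with p hp₁ hp₂
    have hm : Measurable fun s => ‖U (φ p.1) s - U (φ p.2) s‖ₑ :=
      ((hU.comp measurable_prodMk_left).sub (hU.comp measurable_prodMk_left)).enorm
    unfold sectionDist
    rw [← hφ.lintegral_comp hm]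
    refine lintegral_congr_ae ?_
    filter_upwards [hp₁, hp₂] with y h₁ h₂
    rw [h₁, h₂]
  have hmeas : MeasurableSet {p : S × S | sectionDist μ U p.1 p.2 ≤ ε} :=
    measurableSet_le (measurable_sectionDist hU) measurable_const
  unfold nearPairs
  rw [← (hφ.prod hφ).measure_preimage hmeas.nullMeasurableSet]
  refine measure_congr ?_
  filter_upwards [hdist] with p hp
  exact congrArg (· ≤ ε) hp

lemma GraphonEquiv.nearPairs_eq {S₁ S₂ : Type} [MeasurableSpace S₁] [MeasurableSpace S₂]
    {μ₁ : Measure S₁} {μ₂ : Measure S₂} [SFinite μ₁] [SFinite μ₂] {W₁ : S₁ → S₁ → ℝ}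
    {W₂ : S₂ → S₂ → ℝ} (h : GraphonEquiv μ₁ μ₂ W₁ W₂) (ε : ℝ≥0∞) :
    nearPairs μ₁ W₁ ε = nearPairs μ₂ W₂ ε := by
  obtain ⟨S, mS, μ, U, φ₁, φ₂, hμ, hU, -, -, hφ₁, hφ₂, h₁, h₂⟩ := h
  rw [nearPairs_eq_of_pullback hU hφ₁ h₁, nearPairs_eq_of_pullback hU hφ₂ h₂]

/-! ### Hölder graphons on the unit interval -/

/-- The uniform probability measure on `[0,1]`. -/
noncomputable abbrev uniformIcc : Measure ℝ := volume.restrict (Set.Icc (0:ℝ) 1)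

instance isProbabilityMeasure_uniformIcc : IsProbabilityMeasure uniformIcc :=
  ⟨by simp [uniformIcc]⟩

lemma ofReal_le_uniformIcc_near {δ : ℝ} (hδ : δ ≤ 1 / 2) {t : ℝ} (ht : t ∈ Set.Icc (0:ℝ) 1) :
    ENNReal.ofReal δ ≤ uniformIcc {s | |t - s| ≤ δ} := by
  rcases le_or_gt δ 0 with h0 | h0
  · simp [ENNReal.ofReal_of_nonpos h0]
  rw [uniformIcc, Measure.restrict_apply' measurableSet_Icc]
  rcases le_total t (1 / 2) with h | h
  · calc ENNReal.ofReal δ = volume (Set.Icc t (t + δ)) := by simp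
      _ ≤ volume ({s | |t - s| ≤ δ} ∩ Set.Icc 0 1) := measure_mono fun s hs =>
        ⟨show |t - s| ≤ δ from abs_le.2 ⟨by linarith [hs.2], by linarith [hs.1]⟩,
          ⟨by linarith [hs.1, ht.1], by linarith [hs.2]⟩⟩
  · calc ENNReal.ofReal δ = volume (Set.Icc (t - δ) t) := by simp
      _ ≤ volume ({s | |t - s| ≤ δ} ∩ Set.Icc 0 1) := measure_mono fun s hs =>
        ⟨show |t - s| ≤ δ from abs_le.2 ⟨by linarith [hs.2], by linarith [hs.1]⟩,
          ⟨by linarith [hs.1], by linarith [hs.2, ht.2]⟩⟩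

lemma ofReal_le_nearPairs_of_holder {W : ℝ → ℝ → ℝ} {C β δ : ℝ} (hβ : 0 < β) (hC : 0 ≤ C)
    (hδ : δ ≤ 1 / 2)
    (hW : ∀ x ∈ Set.Icc (0:ℝ) 1, ∀ y ∈ Set.Icc (0:ℝ) 1,
      ∀ x' ∈ Set.Icc (0:ℝ) 1, ∀ y' ∈ Set.Icc (0:ℝ) 1,
      |W x y - W x' y'| ≤ C * Real.sqrt ((x - x') ^ 2 + (y - y') ^ 2) ^ β) :
    ENNReal.ofReal δ ≤ nearPairs uniformIcc W (ENNReal.ofReal (C * δ ^ β)) := by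
  have hIcc : ∀ᵐ t ∂uniformIcc, t ∈ Set.Icc (0:ℝ) 1 := ae_restrict_mem measurableSet_Icc
  have hmeas : MeasurableSet {p : ℝ × ℝ | |p.1 - p.2| ≤ δ} :=
    measurableSet_le (by fun_prop) measurable_const
  calc ENNReal.ofReal δ = ∫⁻ _, ENNReal.ofReal δ ∂uniformIcc := by simp
    _ ≤ ∫⁻ t, uniformIcc {s | |t - s| ≤ δ} ∂uniformIcc :=
        lintegral_mono_ae (hIcc.mono fun t ht => ofReal_le_uniformIcc_near hδ ht)
    _ = (uniformIcc.prod uniformIcc) {p | |p.1 - p.2| ≤ δ} := (Measure.prod_apply hmeas).symm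
    _ ≤ nearPairs uniformIcc W (ENNReal.ofReal (C * δ ^ β)) := by
        refine measure_mono_ae ?_
        filter_upwards [Measure.quasiMeasurePreserving_fst.ae hIcc,
          Measure.quasiMeasurePreserving_snd.ae hIcc] with p hp₁ hp₂ hp
        replace hp : |p.1 - p.2| ≤ δ := hp
        change ∫⁻ y, ‖W p.1 y - W p.2 y‖ₑ ∂uniformIcc ≤ _
        calc ∫⁻ y, ‖W p.1 y - W p.2 y‖ₑ ∂uniformIcc
            ≤ ∫⁻ _, ENNReal.ofReal (C * δ ^ β) ∂uniformIcc := by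
              refine lintegral_mono_ae (hIcc.mono fun y hy => ?_)
              rw [Real.enorm_eq_ofReal_abs]
              refine ENNReal.ofReal_le_ofReal ((hW _ hp₁ y hy _ hp₂ y hy).trans ?_)
              rw [sub_self, zero_pow two_ne_zero, add_zero, Real.sqrt_sq_eq_abs]
              gcongr
          _ = _ := by simp

/-! ### Fourier coefficients of the Weierstrass function -/

lemma integral_cos_int_mul_add {n : ℤ} (hn : n ≠ 0) (c : ℝ) :
    ∫ t, Real.cos (2 * Real.pi * n * t + c) ∂uniformIcc = 0 := by
  rw [integral_Icc_eq_integral_Ioc, ← intervalIntegral.integral_of_le zero_le_one,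
    intervalIntegral.integral_comp_mul_add Real.cos (by positivity : 2 * Real.pi * (n:ℝ) ≠ 0),
    integral_cos]
  have : 2 * Real.pi * (n:ℝ) * 1 + c = c + n * (2 * Real.pi) := by ring
  rw [this, Real.sin_add_int_mul_two_pi]
  simp

lemma integral_cos_two_pow_mul_cos (l k : ℕ) (u x : ℝ) :
    ∫ t, Real.cos (2 * Real.pi * 2 ^ l * (u - t)) * Real.cos (2 * Real.pi * 2 ^ k * (t - x))
      ∂uniformIcc = if l = k then Real.cos (2 * Real.pi * 2 ^ k * (u - x)) / 2 else 0 := by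
  have hcos : ∀ t, Real.cos (2 * Real.pi * 2 ^ l * (u - t)) *
      Real.cos (2 * Real.pi * 2 ^ k * (t - x)) =
      (1 / 2) * Real.cos (2 * Real.pi * ((2 ^ k - 2 ^ l : ℤ) : ℝ) * t +
          2 * Real.pi * (2 ^ l * u - 2 ^ k * x)) +
      (1 / 2) * Real.cos (2 * Real.pi * ((-(2 ^ k + 2 ^ l) : ℤ) : ℝ) * t +
          2 * Real.pi * (2 ^ l * u + 2 ^ k * x)) := by
    intro t
    push_cast
    have := Real.two_mul_cos_mul_cos (2 * Real.pi * 2 ^ l * (u - t))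
      (2 * Real.pi * 2 ^ k * (t - x))
    rw [show 2 * Real.pi * ((2:ℝ) ^ k - 2 ^ l) * t + 2 * Real.pi * (2 ^ l * u - 2 ^ k * x) =
        2 * Real.pi * 2 ^ l * (u - t) + 2 * Real.pi * 2 ^ k * (t - x) by ring,
      show 2 * Real.pi * (-((2:ℝ) ^ k + 2 ^ l)) * t + 2 * Real.pi * (2 ^ l * u + 2 ^ k * x) =
        2 * Real.pi * 2 ^ l * (u - t) - 2 * Real.pi * 2 ^ k * (t - x) by ring]
    linarith
  have hint : ∀ b c : ℝ, Integrable (fun t => (1 / 2) * Real.cos (b * t + c)) uniformIcc :=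
    fun b c => (by fun_prop : Continuous fun t => (1 / 2) * Real.cos (b * t + c)).integrableOn_Icc
  simp_rw [hcos]
  rw [integral_add (hint _ _) (hint _ _), integral_const_mul, integral_const_mul,
    integral_cos_int_mul_add (n := -(2 ^ k + 2 ^ l)) (by
      have : (0:ℤ) < 2 ^ k + 2 ^ l := by positivity
      lia)]
  split_ifs with h
  · subst h
    simp only [sub_self, Int.cast_zero, mul_zero, zero_mul, zero_add, add_zero]
    rw [integral_const]
    simp only [probReal_univ, one_smul]
    ring_nf
  · rw [integral_cos_int_mul_add]
    · simp
    · rw [sub_ne_zero]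
      exact fun he => h (Nat.pow_right_injective le_rfl (by exact_mod_cast he.symm))

lemma summable_two_rpow_neg_mul {α : ℝ} (hα : 0 < α) :
    Summable fun k : ℕ => (2:ℝ) ^ (-(k:ℝ) * α) := by
  have h : ∀ k : ℕ, (2:ℝ) ^ (-(k:ℝ) * α) = ((2:ℝ) ^ (-α)) ^ k := fun k => by
    rw [← Real.rpow_mul_natCast zero_le_two]
    ring_nf
  simp_rw [h]
  exact summable_geometric_of_lt_one (by positivity)
    (Real.rpow_lt_one_of_one_lt_of_neg one_lt_two (by linarith))

lemma norm_weierstrass_term_le (α t : ℝ) (k : ℕ) :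
    ‖(2:ℝ) ^ (-(k:ℝ) * α) * Real.cos (2 * Real.pi * 2 ^ k * t)‖ ≤ (2:ℝ) ^ (-(k:ℝ) * α) := by
  rw [norm_mul, Real.norm_of_nonneg (by positivity : (0:ℝ) ≤ 2 ^ (-(k:ℝ) * α))]
  exact mul_le_of_le_one_right (by positivity) (Real.abs_cos_le_one _)

lemma continuous_weierstrass {α : ℝ} (hα : 0 < α) : Continuous (weierstrass α) :=
  continuous_tsum (fun _ => by fun_prop) (summable_two_rpow_neg_mul hα)
    fun k t => norm_weierstrass_term_le α t k

lemma integral_weierstrass_mul_cos {α : ℝ} (hα : 0 < α) (k : ℕ) (u x : ℝ) :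
    ∫ t, weierstrass α (u - t) * Real.cos (2 * Real.pi * 2 ^ k * (t - x)) ∂uniformIcc =
      (2:ℝ) ^ (-(k:ℝ) * α) * Real.cos (2 * Real.pi * 2 ^ k * (u - x)) / 2 := by
  let F : ℕ → ℝ → ℝ := fun l t => (2:ℝ) ^ (-(l:ℝ) * α) *
    (Real.cos (2 * Real.pi * 2 ^ l * (u - t)) * Real.cos (2 * Real.pi * 2 ^ k * (t - x)))
  have hF : ∀ l, Integrable (F l) uniformIcc := fun l =>
    (by fun_prop : Continuous (F l)).integrableOn_Icc
  have hle : ∀ l t, ‖F l t‖ ≤ (2:ℝ) ^ (-(l:ℝ) * α) := fun l t => by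
    simp only [F]
    rw [← mul_assoc, norm_mul]
    exact (mul_le_of_le_one_right (norm_nonneg _) (Real.abs_cos_le_one _)).trans
      (norm_weierstrass_term_le α (u - t) l)
  have hsum : Summable fun l => ∫ t, ‖F l t‖ ∂uniformIcc := by
    refine (summable_two_rpow_neg_mul hα).of_nonneg_of_le
      (fun l => integral_nonneg fun t => norm_nonneg _) fun l => ?_
    calc ∫ t, ‖F l t‖ ∂uniformIcc ≤ ∫ _, (2:ℝ) ^ (-(l:ℝ) * α) ∂uniformIcc :=
          integral_mono (hF l).norm (integrable_const _) (hle l)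
      _ = _ := by simp
  have key := hasSum_integral_of_summable_integral_norm hF hsum
  have htsum : ∀ t, ∑' l, F l t =
      weierstrass α (u - t) * Real.cos (2 * Real.pi * 2 ^ k * (t - x)) := fun t => by
    rw [weierstrass, ← tsum_mul_right]
    exact tsum_congr fun l => (mul_assoc _ _ _).symm
  simp_rw [htsum] at key
  refine key.unique ?_
  simp only [F, integral_const_mul, integral_cos_two_pow_mul_cos]
  refine (hasSum_ite_eq k
    ((2:ℝ) ^ (-(k:ℝ) * α) * Real.cos (2 * Real.pi * 2 ^ k * (u - x)) / 2)).congr_fun fun l => ?_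
  split_ifs with h
  · rw [h, mul_div_assoc]
  · simp

/-! ### The Weierstrass graphon -/

lemma integral_pi_sum_mul {ι : Type} [Fintype ι] {F : ι → ℝ → ℝ} (hF : ∀ j, Continuous (F j))
    {g : ℝ → ℝ} (hg : Continuous g) (hg0 : ∫ t, g t ∂uniformIcc = 0) (i : ι) :
    ∫ y, (∑ j, F j (y j)) * g (y i) ∂(Measure.pi fun _ : ι => uniformIcc) =
      ∫ t, F i t * g t ∂uniformIcc := by
  have hint : ∀ j, Integrable (fun y : ι → ℝ => F j (y j) * g (y i))
      (Measure.pi fun _ : ι => uniformIcc) := fun j => by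
    have hc : Continuous fun y : ι → ℝ => F j (y j) * g (y i) :=
      ((hF j).comp (continuous_apply j)).mul (hg.comp (continuous_apply i))
    rw [uniformIcc, ← Measure.restrict_pi_pi]
    exact hc.continuousOn.integrableOn_compact (isCompact_univ_pi fun _ => isCompact_Icc)
  have heval : ∀ j {f : ℝ → ℝ}, Continuous f →
      ∫ y, f (y j) ∂(Measure.pi fun _ : ι => uniformIcc) = ∫ t, f t ∂uniformIcc := by
    intro j f hf
    have hmp := measurePreserving_eval (fun _ : ι => uniformIcc) j
    have hmap := integral_map (f := f) (μ := Measure.pi fun _ : ι => uniformIcc)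
      hmp.measurable.aemeasurable hf.aestronglyMeasurable
    rw [hmp.map_eq] at hmap
    exact hmap.symm
  simp_rw [Finset.sum_mul]
  rw [integral_finsetSum _ fun j _ => hint j, Finset.sum_eq_single i]
  · exact heval i ((hF i).mul hg)
  · intro j _ hji
    have hind := (ProbabilityTheory.iIndepFun_pi (μ := fun _ : ι => uniformIcc)
      (X := fun _ t => t) fun _ => aemeasurable_id).indepFun hji
    have hmul := (hind.comp (hF j).measurable hg.measurable).integral_fun_mul_eq_mul_integral
      ((hF j).comp (continuous_apply j)).aestronglyMeasurable
      (hg.comp (continuous_apply i)).aestronglyMeasurable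
    simp only [Function.comp_apply] at hmul
    rw [hmul, heval i hg, hg0, mul_zero]
  · simp

lemma measurePreserving_ofLp_unitCube (d : ℕ) :
    MeasurePreserving (WithLp.ofLp : EuclideanSpace ℝ (Fin d) → Fin d → ℝ)
      (volume.restrict (unitCube d)) (Measure.pi fun _ => uniformIcc) := by
  have h := (PiLp.volume_preserving_ofLp (Fin d)).restrict_preimage
    (MeasurableSet.univ_pi fun _ : Fin d => measurableSet_Icc (a := (0:ℝ)) (b := 1))
  rw [volume_pi, Measure.restrict_pi_pi] at h
  have hset : unitCube d = WithLp.ofLp ⁻¹' Set.univ.pi fun _ : Fin d => Set.Icc (0:ℝ) 1 := by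
    ext x
    simp only [unitCube, Set.mem_ofPred_eq, Set.mem_preimage, Set.mem_univ_pi]
  rw [hset]
  exact h

instance isProbabilityMeasure_unitCube (d : ℕ) :
    IsProbabilityMeasure (volume.restrict (unitCube d)) :=
  ⟨by rw [← Set.preimage_univ, (measurePreserving_ofLp_unitCube d).measure_preimage
    MeasurableSet.univ.nullMeasurableSet, measure_univ]⟩

lemma le_sectionDist_weierstrassGraphon {d : ℕ} {α : ℝ} (hα : 0 < α) (a : ℝ)
    (x x' : EuclideanSpace ℝ (Fin d)) (i : Fin d) (k : ℕ) :
    ENNReal.ofReal (a * (2:ℝ) ^ (-(k:ℝ) * α) *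
        (1 - Real.cos (2 * Real.pi * 2 ^ k * (x i - x' i))) / 2) ≤
      sectionDist (volume.restrict (unitCube d)) (weierstrassGraphon d α a) x x' := by
  have hh := continuous_weierstrass hα
  let F : Fin d → ℝ → ℝ := fun j t => a * (weierstrass α (x j - t) - weierstrass α (x' j - t))
  let g : ℝ → ℝ := fun t => Real.cos (2 * Real.pi * 2 ^ k * (t - x i))
  have hF : ∀ j, Continuous (F j) := fun j => by fun_prop
  have hg : Continuous g := by fun_prop
  have hg0 : ∫ t, g t ∂uniformIcc = 0 := by
    rw [← integral_cos_int_mul_add (n := 2 ^ k) (by positivity) (-(2 * Real.pi * 2 ^ k * x i))]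
    refine integral_congr_ae (.of_forall fun t => ?_)
    simp only [g]
    push_cast
    ring_nf
  have hval : ∫ t, F i t * g t ∂uniformIcc = a * (2:ℝ) ^ (-(k:ℝ) * α) *
      (1 - Real.cos (2 * Real.pi * 2 ^ k * (x i - x' i))) / 2 := by
    have hint : ∀ u, Integrable (fun t => a * (weierstrass α (u - t) * g t)) uniformIcc :=
      fun u => (by fun_prop :
        Continuous fun t => a * (weierstrass α (u - t) * g t)).integrableOn_Icc
    have hsub : ∀ t, F i t * g t =
        a * (weierstrass α (x i - t) * g t) - a * (weierstrass α (x' i - t) * g t) := fun t => by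
      simp only [F]
      ring
    simp_rw [hsub]
    rw [integral_sub (hint _) (hint _), integral_const_mul, integral_const_mul,
      integral_weierstrass_mul_cos hα, integral_weierstrass_mul_cos hα, sub_self, mul_zero,
      Real.cos_zero, ← Real.cos_neg (2 * Real.pi * 2 ^ k * (x' i - x i)), ← mul_neg, neg_sub]
    ring
  have hdist : sectionDist (volume.restrict (unitCube d)) (weierstrassGraphon d α a) x x' =
      ∫⁻ y, ‖∑ j, F j (y j)‖ₑ ∂(Measure.pi fun _ : Fin d => uniformIcc) := by
    rw [← (measurePreserving_ofLp_unitCube d).lintegral_comp (by fun_prop), sectionDist]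
    refine lintegral_congr fun y => congrArg _ ?_
    simp only [weierstrassGraphon, F, ← Finset.mul_sum, Finset.sum_sub_distrib]
    ring
  rw [hdist, ← hval, ← integral_pi_sum_mul hF hg hg0 i]
  calc ENNReal.ofReal (∫ y, (∑ j, F j (y j)) * g (y i) ∂(Measure.pi fun _ : Fin d => uniformIcc))
      ≤ ‖∫ y, (∑ j, F j (y j)) * g (y i) ∂(Measure.pi fun _ : Fin d => uniformIcc)‖ₑ :=
        Real.ofReal_le_enorm _
    _ ≤ ∫⁻ y, ‖(∑ j, F j (y j)) * g (y i)‖ₑ ∂(Measure.pi fun _ : Fin d => uniformIcc) :=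
        enorm_integral_le_lintegral_enorm _
    _ ≤ _ := by
        refine lintegral_mono fun y => ?_
        rw [enorm_mul]
        refine mul_le_of_le_one_right' ?_
        rw [Real.enorm_eq_ofReal_abs]
        exact ENNReal.ofReal_le_one.2 (Real.abs_cos_le_one _)

lemma exists_int_abs_sub_le_of_cos_pos {θ : ℝ} {K : ℕ}
    (h : ∀ k ≤ K, 0 < Real.cos (2 * Real.pi * 2 ^ k * θ)) :
    ∃ m : ℤ, |θ - m| ≤ (1 / 4) / 2 ^ K := by
  have hπ := Real.pi_pos
  have near : ∀ t : ℝ, |t| ≤ 1 / 2 → 0 < Real.cos (2 * Real.pi * t) → |t| ≤ 1 / 4 := by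
    intro t ht hcos
    by_contra! hlt
    rw [← Real.cos_abs, abs_mul, abs_of_pos (by positivity : 0 < 2 * Real.pi)] at hcos
    have := Real.cos_nonpos_of_pi_div_two_le_of_le (x := 2 * Real.pi * |t|)
      (by nlinarith) (by nlinarith)
    linarith
  have hper : ∀ (k : ℕ) (m : ℤ), Real.cos (2 * Real.pi * (2 ^ k * (θ - m))) =
      Real.cos (2 * Real.pi * 2 ^ k * θ) := fun k m => by
    rw [← Real.cos_sub_int_mul_two_pi (2 * Real.pi * 2 ^ k * θ) (2 ^ k * m)]
    push_cast
    ring_nf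
  refine ⟨round θ, ?_⟩
  have hind : ∀ k ≤ K, |(2:ℝ) ^ k * (θ - round θ)| ≤ 1 / 4 := by
    intro k
    induction k with
    | zero =>
      intro hk
      refine near _ (by simpa using abs_sub_round θ) ?_
      rw [hper]
      exact h 0 hk
    | succ k ih =>
      intro hk
      refine near _ ?_ ?_
      · have := ih (by lia)
        rw [pow_succ', mul_assoc, abs_mul, abs_two]
        linarith
      · rw [hper]
        exact h _ hk
  have hK := hind K le_rfl
  rw [abs_mul, abs_of_pos (by positivity)] at hK
  rw [le_div_iff₀ (by positivity), mul_comm]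
  exact hK

lemma uniformIcc_near_int_le {s r : ℝ} (hs : s ∈ Set.Icc (0:ℝ) 1) (hr' : r < 1) :
    uniformIcc {t | ∃ m : ℤ, |s - t - m| ≤ r} ≤ ENNReal.ofReal (6 * r) := by
  rw [uniformIcc, Measure.restrict_apply' measurableSet_Icc]
  have hsub : {t | ∃ m : ℤ, |s - t - m| ≤ r} ∩ Set.Icc (0:ℝ) 1 ⊆
      ⋃ m ∈ Finset.Icc (-1 : ℤ) 1, Set.Icc (s - m - r) (s - m + r) := by
    rintro t ⟨⟨m, hm⟩, ht⟩
    rw [abs_le] at hm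
    have h₁ : (-2:ℝ) < m := by linarith [hm.2, hs.1, ht.2]
    have h₂ : (m:ℝ) < 2 := by linarith [hm.1, hs.2, ht.1]
    have h₁' : (-2:ℤ) < m := by exact_mod_cast h₁
    have h₂' : m < 2 := by exact_mod_cast h₂
    simp only [Set.mem_iUnion, Finset.mem_Icc]
    exact ⟨m, ⟨by lia, by lia⟩, by linarith [hm.2], by linarith [hm.1]⟩
  calc volume ({t | ∃ m : ℤ, |s - t - m| ≤ r} ∩ Set.Icc (0:ℝ) 1)
      ≤ ∑ m ∈ Finset.Icc (-1 : ℤ) 1, volume (Set.Icc (s - m - r) (s - m + r)) :=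
        (measure_mono hsub).trans (measure_biUnion_finset_le _ _)
    _ = ∑ m ∈ Finset.Icc (-1 : ℤ) 1, ENNReal.ofReal (2 * r) := by
        refine Finset.sum_congr rfl fun m _ => ?_
        rw [Real.volume_Icc]
        ring_nf
    _ = ENNReal.ofReal (6 * r) := by
        rw [Finset.sum_const, nsmul_eq_mul, show (Finset.Icc (-1 : ℤ) 1).card = 3 by rfl,
          ← ENNReal.ofReal_natCast, ← ENNReal.ofReal_mul (by norm_num)]
        congr 1
        push_cast
        ring

lemma unitCube_near_lattice_le {d : ℕ} {x : EuclideanSpace ℝ (Fin d)} (hx : x ∈ unitCube d)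
    {r : ℝ} (hr : 0 ≤ r) (hr' : r < 1) :
    volume.restrict (unitCube d) {x' | ∀ i, ∃ m : ℤ, |x i - x' i - m| ≤ r} ≤
      ENNReal.ofReal ((6 * r) ^ d) := by
  let B : Fin d → Set ℝ := fun i => {t | ∃ m : ℤ, |x i - t - m| ≤ r}
  have hB : ∀ i, MeasurableSet (B i) := fun i => by
    simp only [B, Set.ofPred_exists]
    exact MeasurableSet.iUnion fun m => measurableSet_le (by fun_prop) measurable_const
  have hpre : {x' : EuclideanSpace ℝ (Fin d) | ∀ i, ∃ m : ℤ, |x i - x' i - m| ≤ r} =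
      WithLp.ofLp ⁻¹' Set.univ.pi B := by
    ext x'
    simp [B]
  rw [hpre, (measurePreserving_ofLp_unitCube d).measure_preimage
    (MeasurableSet.univ_pi hB).nullMeasurableSet, Measure.pi_pi]
  calc ∏ i, uniformIcc (B i) ≤ ∏ _i : Fin d, ENNReal.ofReal (6 * r) :=
        Finset.prod_le_prod' fun i _ => uniformIcc_near_int_le (hx i) hr'
    _ = ENNReal.ofReal ((6 * r) ^ d) := by
        rw [Finset.prod_const, Finset.card_univ, Fintype.card_fin,
          ENNReal.ofReal_pow (by positivity)]

lemma nearPairs_weierstrassGraphon_le {d : ℕ} {α a : ℝ} (hα : 0 < α) (ha : 0 < a) (K : ℕ) :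
    nearPairs (volume.restrict (unitCube d)) (weierstrassGraphon d α a)
        (ENNReal.ofReal (a / 4 * (2:ℝ) ^ (-(K:ℝ) * α))) ≤
      ENNReal.ofReal ((6 * (1 / 4 / 2 ^ K)) ^ d) := by
  let r : ℝ := 1 / 4 / 2 ^ K
  have hr : 0 ≤ r := by positivity
  have hr' : r < 1 := (div_le_self (by norm_num) (one_le_pow₀ one_le_two)).trans_lt (by norm_num)
  let T : Set (EuclideanSpace ℝ (Fin d) × EuclideanSpace ℝ (Fin d)) :=
    {p | ∀ i, ∃ m : ℤ, |p.1 i - p.2 i - m| ≤ r}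
  have hT : MeasurableSet T := by
    simp only [T, Set.ofPred_forall, Set.ofPred_exists]
    exact MeasurableSet.iInter fun i => MeasurableSet.iUnion fun m =>
      measurableSet_le (by fun_prop) measurable_const
  have hcube : MeasurableSet (unitCube d) := by
    simp only [unitCube, Set.ofPred_forall]
    exact MeasurableSet.iInter fun i => measurableSet_Icc.preimage (by fun_prop)
  have hsub : {p : EuclideanSpace ℝ (Fin d) × EuclideanSpace ℝ (Fin d) |
      sectionDist (volume.restrict (unitCube d)) (weierstrassGraphon d α a) p.1 p.2 ≤
        ENNReal.ofReal (a / 4 * (2:ℝ) ^ (-(K:ℝ) * α))} ⊆ T := by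
    rintro ⟨x, x'⟩ hp i
    refine exists_int_abs_sub_le_of_cos_pos fun k hk => ?_
    have hle := (le_sectionDist_weierstrassGraphon hα a x x' i k).trans hp
    rw [ENNReal.ofReal_le_ofReal_iff (by positivity)] at hle
    have hmono : (2:ℝ) ^ (-(K:ℝ) * α) ≤ (2:ℝ) ^ (-(k:ℝ) * α) := by
      refine Real.rpow_le_rpow_of_exponent_le one_le_two ?_
      have : (k:ℝ) ≤ K := by exact_mod_cast hk
      nlinarith
    have hpos : (0:ℝ) < a * (2:ℝ) ^ (-(k:ℝ) * α) := by positivity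
    have hmono' := mul_le_mul_of_nonneg_left hmono ha.le
    by_contra! hcos
    nlinarith
  calc _ ≤ ((volume.restrict (unitCube d)).prod (volume.restrict (unitCube d))) T :=
        measure_mono hsub
    _ = ∫⁻ x, volume.restrict (unitCube d) (Prod.mk x ⁻¹' T) ∂(volume.restrict (unitCube d)) :=
        Measure.prod_apply hT
    _ ≤ ∫⁻ _, ENNReal.ofReal ((6 * r) ^ d) ∂(volume.restrict (unitCube d)) :=
        lintegral_mono_ae ((ae_restrict_mem hcube).mono fun x hx =>
          unitCube_near_lattice_le hx hr hr')
    _ = ENNReal.ofReal ((6 * r) ^ d) := by simp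

/-- **Example 2.** The Weierstrass-type graphon on `[0,1]^d` (`d ≥ 2`) is not
equivalent to any Hölder(β) graphon on `[0,1]` when `β > α/d`. -/
theorem weierstrassGraphon_not_equivalent_holder (d : ℕ) (hd : 2 ≤ d)
    (α : ℝ) (hα0 : 0 < α) (hα1 : α < 1) (a : ℝ) (ha : 0 < a)
    (ha' : a * d * ∑' k : ℕ, (2:ℝ) ^ (-(k:ℝ) * α) ≤ 1 / 2)
    (β : ℝ) (hβ : α / d < β) (hβ1 : β ≤ 1) :
    ¬ ∃ W' : ℝ → ℝ → ℝ,
        Measurable (Function.uncurry W') ∧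
        (∀ x ∈ Set.Icc (0:ℝ) 1, ∀ y ∈ Set.Icc (0:ℝ) 1, W' x y = W' y x) ∧
        (∀ x ∈ Set.Icc (0:ℝ) 1, ∀ y ∈ Set.Icc (0:ℝ) 1, W' x y ∈ Set.Icc (0:ℝ) 1) ∧
        (∃ C : ℝ, ∀ x ∈ Set.Icc (0:ℝ) 1, ∀ y ∈ Set.Icc (0:ℝ) 1,
          ∀ x' ∈ Set.Icc (0:ℝ) 1, ∀ y' ∈ Set.Icc (0:ℝ) 1,
          |W' x y - W' x' y'| ≤ C * Real.sqrt ((x - x') ^ 2 + (y - y') ^ 2) ^ β) ∧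
        GraphonEquiv (volume.restrict (unitCube d)) (volume.restrict (Set.Icc (0:ℝ) 1))
          (weierstrassGraphon d α a) W' := by
  rintro ⟨W', -, -, -, ⟨C₀, hC₀⟩, hequiv⟩
  have hd0 : (0:ℝ) < d := by positivity
  have hβ0 : 0 < β := (by positivity : 0 < α / d).trans hβ
  let C : ℝ := max C₀ a
  have hCa : a ≤ C := le_max_right _ _
  have hC : 0 < C := ha.trans_le hCa
  let c : ℝ := a / 4 / C
  have hc : 0 < c := by positivity
  have hc4 : c ≤ 1 / 4 := by
    rw [div_le_iff₀ hC]
    linarith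
  have hgap : 0 < d - α / β := by
    rw [sub_pos, div_lt_iff₀ hβ0]
    rw [div_lt_iff₀ hd0] at hβ
    linarith
  have key : ∀ K : ℕ, c ^ β⁻¹ * ((2:ℝ) ^ (d - α / β)) ^ K ≤ (6 / 4) ^ d := by
    intro K
    let δ : ℝ := (c * (2:ℝ) ^ (-(K:ℝ) * α)) ^ β⁻¹
    have hpow : (2:ℝ) ^ (-(K:ℝ) * α) ≤ 1 :=
      Real.rpow_le_one_of_one_le_of_nonpos one_le_two (by
        have : (0:ℝ) ≤ K * α := by positivity
        linarith)
    have hbase : c * (2:ℝ) ^ (-(K:ℝ) * α) ≤ 1 / 4 :=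
      (mul_le_of_le_one_right hc.le hpow).trans hc4
    have hδ : δ ≤ 1 / 2 := by
      have h₁ : δ ≤ c * (2:ℝ) ^ (-(K:ℝ) * α) :=
        (Real.rpow_le_rpow_of_exponent_ge (by positivity) (by linarith)
          ((one_le_inv₀ hβ0).2 hβ1)).trans_eq (Real.rpow_one _)
      linarith
    have hδβ : C * δ ^ β = a / 4 * (2:ℝ) ^ (-(K:ℝ) * α) := by
      simp only [δ]
      rw [Real.rpow_inv_rpow (by positivity) hβ0.ne']
      simp only [c]
      field_simp
    have hlow := ofReal_le_nearPairs_of_holder (W := W') (C := C) hβ0 hC.le hδ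
      fun x hx y hy x' hx' y' hy' => (hC₀ x hx y hy x' hx' y' hy').trans (by
        gcongr
        exact le_max_left _ _)
    rw [hδβ, ← hequiv.nearPairs_eq] at hlow
    have hle := hlow.trans (nearPairs_weierstrassGraphon_le hα0 ha K)
    rw [ENNReal.ofReal_le_ofReal_iff (by positivity)] at hle
    have hδeq : δ * ((2:ℝ) ^ K) ^ d = c ^ β⁻¹ * ((2:ℝ) ^ (d - α / β)) ^ K := by
      simp only [δ]
      rw [Real.mul_rpow hc.le (by positivity), ← Real.rpow_mul zero_le_two,
        ← Real.rpow_mul_natCast zero_le_two, ← pow_mul, ← Real.rpow_natCast, mul_assoc,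
        ← Real.rpow_add two_pos]
      congr 2
      push_cast
      field_simp
      ring
    rw [← hδeq]
    calc δ * ((2:ℝ) ^ K) ^ d ≤ (6 * (1 / 4 / 2 ^ K)) ^ d * ((2:ℝ) ^ K) ^ d := by gcongr
      _ = (6 / 4) ^ d := by
        rw [← mul_pow]
        congr 1
        field_simp
  have hlim := (tendsto_pow_atTop_atTop_of_one_lt
    (Real.one_lt_rpow one_lt_two hgap)).const_mul_atTop (by positivity : 0 < c ^ β⁻¹)
  obtain ⟨K, hK⟩ := (hlim.eventually_gt_atTop ((6 / 4) ^ d)).exists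
  exact absurd (key K) (not_le.2 hK)
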